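/- Let w = (w_1,…,w_n) be a permutation of {1,…,n} with k local minima and j local maxima, and suppose k < j. Let α be the composition (k, 1, 1, …, 1, j) of n consisting of a first part k, followed by n−k−j parts equal to 1, and a last part j, and let α^r = (j, 1, 1, …, 1, k) be its reverse. Then N_{P_w}(α, n−1) > 0 and N_{P_w}(α^r, n−1) = 0. -/

import Mathlib

/-- A proper coloring of a labeled graph on vertex set `Fin n` (vertex `v` represents
label `v+1`), with colors in `{1,2,...}`. -/
def properColoring {n : ℕ} (G : SimpleGraph (Fin n)) (c : Fin n → ℕ) : Prop :=
  ∀ u v : Fin n, G.Adj u v → c u ≠ c v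

/-- The ascent number of a coloring: the number of edges `uv` with `u < v` and `c u < c v`. -/
noncomputable def ascNum {n : ℕ} (G : SimpleGraph (Fin n)) (c : Fin n → ℕ) : ℕ :=
  Nat.card {p : Fin n × Fin n // p.1 < p.2 ∧ G.Adj p.1 p.2 ∧ c p.1 < c p.2}

/-- The descent number of a coloring: the number of edges `uv` with `u < v` and `c u > c v`. -/
noncomputable def desNum {n : ℕ} (G : SimpleGraph (Fin n)) (c : Fin n → ℕ) : ℕ :=
  Nat.card {p : Fin n × Fin n // p.1 < p.2 ∧ G.Adj p.1 p.2 ∧ c p.2 < c p.1}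

/-- The coloring `c` uses exactly the colors `1,…,L.length`, color `a` being used
exactly `L.get (a-1)` times. -/
def usesPalette {n : ℕ} (L : List ℕ) (c : Fin n → ℕ) : Prop :=
  (∀ v : Fin n, 1 ≤ c v ∧ c v ≤ L.length) ∧
  ∀ i : Fin L.length, Nat.card {v : Fin n // c v = (i : ℕ) + 1} = L.get i

/-- `NG G L k` is the number of proper colorings of `G` with ascent number `k`
and palette `L`. -/
noncomputable def NG {n : ℕ} (G : SimpleGraph (Fin n)) (L : List ℕ) (k : ℕ) : ℕ :=
  Nat.card {c : Fin n → ℕ // properColoring G c ∧ usesPalette L c ∧ ascNum G c = k}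

/-- `L` is a composition of `n`: a list of positive integers summing to `n`. -/
def IsComposition (n : ℕ) (L : List ℕ) : Prop :=
  (∀ a ∈ L, 0 < a) ∧ L.sum = n

/-- The chromatic quasisymmetric function of `G` is symmetric. -/
def cqfSymmetric {n : ℕ} (G : SimpleGraph (Fin n)) : Prop :=
  ∀ L M : List ℕ, IsComposition n L → IsComposition n M → List.Perm L M →
    ∀ k : ℕ, NG G L k = NG G M k

/-- The number of edges of `G`. -/
noncomputable def edgeCount {n : ℕ} (G : SimpleGraph (Fin n)) : ℕ := Nat.card G.edgeSet

/-- The chromatic quasisymmetric function of `G` is palindromic. -/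
def cqfPalindromic {n : ℕ} (G : SimpleGraph (Fin n)) : Prop :=
  ∀ L : List ℕ, IsComposition n L →
    ∀ k : ℕ, k ≤ edgeCount G → NG G L k = NG G L (edgeCount G - k)

/-- The labeled path `P_w` of a permutation `w` of `Fin n`: edges `{w i, w (i+1)}`. -/
def pathGraph {n : ℕ} (w : Equiv.Perm (Fin n)) : SimpleGraph (Fin n) :=
  SimpleGraph.fromRel (fun u v => ∃ i : ℕ, ∃ h : i + 1 < n,
    u = w ⟨i, by omega⟩ ∧ v = w ⟨i + 1, h⟩)

/-- The flipped labeled graph: `uv` is an edge iff `(n+1-u)(n+1-v)` is an edge of `G`. -/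
def flipGraph {n : ℕ} (G : SimpleGraph (Fin n)) : SimpleGraph (Fin n) :=
  SimpleGraph.comap Fin.rev G

/-- The ascent-descent pattern of `w`, where `true` records an ascent (`a`) and
`false` records a descent (`d`). -/
def adPattern {n : ℕ} (w : Equiv.Perm (Fin n)) : List Bool :=
  List.ofFn (fun i : Fin (n - 1) =>
    decide (w ⟨(i : ℕ), by have := i.isLt; omega⟩ < w ⟨(i : ℕ) + 1, by have := i.isLt; omega⟩))

/-- The ribbon word `a^{α₁-1} d a^{α₂-1} d ⋯ d a^{α_ℓ-1}` of a composition. -/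
def ribbonWord : List ℕ → List Bool
  | [] => []
  | [a] => List.replicate (a - 1) true
  | a :: b :: rest => List.replicate (a - 1) true ++ false :: ribbonWord (b :: rest)

/-- Position `i` is a local minimum of `w`. -/
def LocalMinAt {n : ℕ} (w : Equiv.Perm (Fin n)) (i : Fin n) : Prop :=
  (∀ _ : 0 < (i : ℕ), w i < w ⟨(i : ℕ) - 1, by have := i.isLt; omega⟩) ∧
  (∀ h : (i : ℕ) + 1 < n, w i < w ⟨(i : ℕ) + 1, h⟩)

/-- Position `i` is a local maximum of `w`. -/
def LocalMaxAt {n : ℕ} (w : Equiv.Perm (Fin n)) (i : Fin n) : Prop :=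
  (∀ _ : 0 < (i : ℕ), w ⟨(i : ℕ) - 1, by have := i.isLt; omega⟩ < w i) ∧
  (∀ h : (i : ℕ) + 1 < n, w ⟨(i : ℕ) + 1, h⟩ < w i)

/-- The labeled star `K_{1,n-1}` with central vertex `j`. -/
def starGraph (n : ℕ) (j : Fin n) : SimpleGraph (Fin n) :=
  SimpleGraph.fromRel (fun u v => u = j ∧ v ≠ j)

/-- The `i`-th edge of the labeled path `P_w`, with its smaller endpoint first. -/
def pathEdge {n : ℕ} (w : Equiv.Perm (Fin n)) (i : Fin (n - 1)) : Fin n × Fin n :=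
  (min (w ⟨i, by omega⟩) (w ⟨i + 1, by omega⟩), max (w ⟨i, by omega⟩) (w ⟨i + 1, by omega⟩))

theorem pathGraph_adj_iff {n : ℕ} (w : Equiv.Perm (Fin n)) (a b : Fin n) :
    (pathGraph w).Adj (w a) (w b) ↔ (a : ℕ) + 1 = b ∨ (b : ℕ) + 1 = a := by
  simp only [pathGraph, SimpleGraph.fromRel_adj, ne_eq, EmbeddingLike.apply_eq_iff_eq]
  constructor
  · rintro ⟨-, ⟨i, h, rfl, rfl⟩ | ⟨i, h, rfl, rfl⟩⟩ <;> simp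
  · intro h
    refine ⟨by rintro rfl; omega, ?_⟩
    rcases h with h | h
    · exact Or.inl ⟨a, by omega, rfl, Fin.ext h.symm⟩
    · exact Or.inr ⟨b, by omega, rfl, Fin.ext h.symm⟩

theorem exists_pathEdge_eq_iff {n : ℕ} (w : Equiv.Perm (Fin n)) (p : Fin n × Fin n) :
    (∃ i, pathEdge w i = p) ↔ p.1 < p.2 ∧ (pathGraph w).Adj p.1 p.2 := by
  constructor
  · rintro ⟨i, rfl⟩
    have hadj := (pathGraph_adj_iff w ⟨i, by omega⟩ ⟨i + 1, by omega⟩).2 (Or.inl rfl)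
    rcases lt_or_gt_of_ne hadj.ne with h | h
    · simpa [pathEdge, min_eq_left h.le, max_eq_right h.le] using ⟨h, hadj⟩
    · simpa [pathEdge, min_eq_right h.le, max_eq_left h.le] using ⟨h, hadj.symm⟩
  · obtain ⟨u, v⟩ := p
    obtain ⟨a, rfl⟩ := w.surjective u
    obtain ⟨b, rfl⟩ := w.surjective v
    rintro ⟨hlt, hadj⟩
    simp only at hlt hadj
    rcases (pathGraph_adj_iff w a b).1 hadj with h | h
    · refine ⟨⟨a, by omega⟩, ?_⟩
      have hb : (⟨a + 1, by omega⟩ : Fin n) = b := Fin.ext h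
      simp [pathEdge, hb, hlt.le]
    · refine ⟨⟨b, by omega⟩, ?_⟩
      have ha : (⟨b + 1, by omega⟩ : Fin n) = a := Fin.ext h
      simp [pathEdge, ha, hlt.le]

theorem pathEdge_injective {n : ℕ} (w : Equiv.Perm (Fin n)) :
    Function.Injective (pathEdge w) := by
  intro i i' h
  simp only [pathEdge, Prod.mk.injEq] at h
  obtain ⟨hmin, hmax⟩ := h
  have key : (w ⟨i, by omega⟩ = w ⟨i', by omega⟩ ∧ w ⟨i + 1, by omega⟩ = w ⟨i' + 1, by omega⟩) ∨
      (w ⟨i, by omega⟩ = w ⟨i' + 1, by omega⟩ ∧ w ⟨i + 1, by omega⟩ = w ⟨i', by omega⟩) := by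
    grind
  simp only [EmbeddingLike.apply_eq_iff_eq, Fin.mk.injEq] at key
  ext
  omega

theorem ascNum_pathGraph_eq_iff {n : ℕ} (w : Equiv.Perm (Fin n)) (c : Fin n → ℕ) :
    ascNum (pathGraph w) c = n - 1 ↔
      ∀ u v, u < v → (pathGraph w).Adj u v → c u < c v := by
  classical
  set E : Finset (Fin n × Fin n) := Finset.univ.image (pathEdge w) with hE
  have mem_E (p : Fin n × Fin n) : p ∈ E ↔ p.1 < p.2 ∧ (pathGraph w).Adj p.1 p.2 := by
    rw [← exists_pathEdge_eq_iff]
    simp [hE]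
  have card_E : E.card = n - 1 := by
    simp [hE, Finset.card_image_of_injective _ (pathEdge_injective w)]
  have hasc : ascNum (pathGraph w) c = (E.filter fun p => c p.1 < c p.2).card := by
    rw [ascNum, Nat.subtype_card]
    intro p
    rw [Finset.mem_filter, mem_E, and_assoc]
  rw [hasc, ← card_E, Finset.card_filter_eq_iff]
  simp only [mem_E, Prod.forall, and_imp]

theorem localMinAt_iff {n : ℕ} (w : Equiv.Perm (Fin n)) (i : Fin n) :
    LocalMinAt w i ↔ ∀ v, (pathGraph w).Adj (w i) v → w i < v := by
  constructor
  · rintro ⟨h₁, h₂⟩ v hv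
    obtain ⟨a, rfl⟩ := w.surjective v
    rcases (pathGraph_adj_iff w i a).1 hv with h | h
    · rw [(Fin.ext h.symm : a = ⟨i + 1, by omega⟩)]
      exact h₂ _
    · rw [(Fin.ext (by simp; omega) : a = ⟨i - 1, by omega⟩)]
      exact h₁ (by omega)
  · refine fun h => ⟨fun hi => h _ ?_, fun hi => h _ ?_⟩ <;> rw [pathGraph_adj_iff] <;> simp
    omega

theorem localMaxAt_iff {n : ℕ} (w : Equiv.Perm (Fin n)) (i : Fin n) :
    LocalMaxAt w i ↔ ∀ v, (pathGraph w).Adj (w i) v → v < w i := by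
  constructor
  · rintro ⟨h₁, h₂⟩ v hv
    obtain ⟨a, rfl⟩ := w.surjective v
    rcases (pathGraph_adj_iff w i a).1 hv with h | h
    · rw [(Fin.ext h.symm : a = ⟨i + 1, by omega⟩)]
      exact h₂ _
    · rw [(Fin.ext (by simp; omega) : a = ⟨i - 1, by omega⟩)]
      exact h₁ (by omega)
  · refine fun h => ⟨fun hi => h _ ?_, fun hi => h _ ?_⟩ <;> rw [pathGraph_adj_iff] <;> simp
    omega

theorem localMinAt_iff_localMaxAt_of_le_one {n : ℕ} (hn : n ≤ 1) (w : Equiv.Perm (Fin n))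
    (i : Fin n) : LocalMinAt w i ↔ LocalMaxAt w i := by
  constructor <;> exact fun _ => ⟨fun _ => by omega, fun _ => by omega⟩

theorem not_localMaxAt_of_localMinAt {n : ℕ} (hn : 2 ≤ n) {w : Equiv.Perm (Fin n)} {i : Fin n}
    (hmin : LocalMinAt w i) : ¬ LocalMaxAt w i := by
  intro hmax
  rcases Nat.eq_zero_or_pos (i : ℕ) with h | h
  · exact lt_asymm (hmin.2 (by omega)) (hmax.2 (by omega))
  · exact lt_asymm (hmin.1 h) (hmax.1 h)

theorem finite_usesPalette {n : ℕ} (L : List ℕ) : {c : Fin n → ℕ | usesPalette L c}.Finite :=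
  (Set.Finite.pi' fun _ : Fin n => Set.finite_Iic L.length).subset
    fun _ hc v => (hc.1 v).2

/-- A coloring with the maximal number of ascents exists whose first color class consists of the
local minima and whose last color class consists of the local maxima. -/
theorem exists_coloring_of_localExtrema {n : ℕ} (hn : 2 ≤ n) (w : Equiv.Perm (Fin n)) (k j : ℕ)
    (hk : Nat.card {i : Fin n // LocalMinAt w i} = k)
    (hj : Nat.card {i : Fin n // LocalMaxAt w i} = j) :
    ∃ c : Fin n → ℕ, (∀ u v, u < v → (pathGraph w).Adj u v → c u < c v) ∧
      usesPalette (k :: (List.replicate (n - k - j) 1 ++ [j])) c := by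
  classical
  set A : Finset (Fin n) := Finset.univ.filter fun v => LocalMinAt w (w.symm v) with hA
  set B : Finset (Fin n) := Finset.univ.filter fun v => LocalMaxAt w (w.symm v) with hB
  have mem_A (v : Fin n) : v ∈ A ↔ ∀ u, (pathGraph w).Adj v u → v < u := by
    simp [hA, localMinAt_iff]
  have mem_B (v : Fin n) : v ∈ B ↔ ∀ u, (pathGraph w).Adj v u → u < v := by
    simp [hB, localMaxAt_iff]
  have card_A : A.card = k := by
    rw [← hk, ← Nat.card_congr (w.symm.subtypeEquiv fun _ => Iff.rfl :
      {v // LocalMinAt w (w.symm v)} ≃ {i // LocalMinAt w i}), Nat.subtype_card]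
    simp [hA]
  have card_B : B.card = j := by
    rw [← hj, ← Nat.card_congr (w.symm.subtypeEquiv fun _ => Iff.rfl :
      {v // LocalMaxAt w (w.symm v)} ≃ {i // LocalMaxAt w i}), Nat.subtype_card]
    simp [hB]
  have hAB : Disjoint A B := by
    rw [Finset.disjoint_left]
    intro v hvA hvB
    simp only [hA, hB, Finset.mem_filter, Finset.mem_univ, true_and] at hvA hvB
    exact not_localMaxAt_of_localMinAt hn hvA hvB
  set m := n - k - j with hm
  have card_compl : (A ∪ B)ᶜ.card = m := by
    rw [Finset.card_compl, Finset.card_union_of_disjoint hAB, Fintype.card_fin]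
    omega
  set e := (A ∪ B)ᶜ.orderIsoOfFin card_compl
  have mem_compl {v : Fin n} : v ∈ (A ∪ B)ᶜ ↔ v ∉ A ∧ v ∉ B := by simp
  set c : Fin n → ℕ := fun v => if hvA : v ∈ A then 1 else if hvB : v ∈ B then m + 2 else
    e.symm ⟨v, mem_compl.2 ⟨hvA, hvB⟩⟩ + 2 with hc
  have c_of_mem_A {v : Fin n} (h : v ∈ A) : c v = 1 := by simp [hc, h]
  have c_of_mem_B {v : Fin n} (h : v ∈ B) : c v = m + 2 := by
    simp [hc, h, Finset.disjoint_right.1 hAB h]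
  have c_of_mem_compl {v : Fin n} (h : v ∈ (A ∪ B)ᶜ) : c v = e.symm ⟨v, h⟩ + 2 := by
    simp [hc, (mem_compl.1 h).1, (mem_compl.1 h).2]
  have cases_mem (v : Fin n) : v ∈ A ∨ v ∈ B ∨ v ∈ (A ∪ B)ᶜ := by
    rw [mem_compl]
    tauto
  refine ⟨c, fun u v huv hadj => ?_, fun v => ?_, ?_⟩
  · have hu : u ∉ B := fun h => lt_asymm huv ((mem_B u).1 h v hadj)
    have hv : v ∉ A := fun h => lt_asymm huv ((mem_A v).1 h u hadj.symm)
    rcases cases_mem u with hu' | hu' | hu'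
    · rcases cases_mem v with hv' | hv' | hv'
      · exact absurd hv' hv
      · rw [c_of_mem_A hu', c_of_mem_B hv']
        omega
      · rw [c_of_mem_A hu', c_of_mem_compl hv']
        omega
    · exact absurd hu' hu
    · rcases cases_mem v with hv' | hv' | hv'
      · exact absurd hv' hv
      · rw [c_of_mem_compl hu', c_of_mem_B hv']
        omega
      · rw [c_of_mem_compl hu', c_of_mem_compl hv', Nat.add_lt_add_iff_right, Fin.val_fin_lt,
          e.symm.lt_iff_lt]
        exact huv
  · rcases cases_mem v with hv | hv | hv
    · simp [c_of_mem_A hv]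
    · simp [c_of_mem_B hv]
    · simp [c_of_mem_compl hv]
  · rintro ⟨i, hi⟩
    simp only [List.length_cons, List.length_append, List.length_replicate, List.length_nil]
      at hi
    have c_eq_iff (v : Fin n) : (c v = 1 ↔ v ∈ A) ∧ (c v = m + 2 ↔ v ∈ B) := by
      rcases cases_mem v with hv | hv | hv
      · simp [c_of_mem_A hv, hv, Finset.disjoint_left.1 hAB hv]
      · simp [c_of_mem_B hv, hv, Finset.disjoint_right.1 hAB hv]
      · have := (e.symm ⟨v, hv⟩).isLt
        simp [c_of_mem_compl hv, (mem_compl.1 hv).1, (mem_compl.1 hv).2]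
        omega
    rcases i with - | i
    · simp only [List.get_eq_getElem, List.getElem_cons_zero, zero_add]
      rw [Nat.subtype_card A fun v => (c_eq_iff v).1.symm, card_A]
    · rcases (by omega : i < m ∨ i = m) with him | rfl
      · simp only [List.get_eq_getElem, List.getElem_cons_succ]
        rw [List.getElem_append_left (by simpa using him), List.getElem_replicate,
          Nat.subtype_card {(e ⟨i, him⟩ : Fin n)}, Finset.card_singleton]
        intro v
        rw [Finset.mem_singleton]
        constructor
        · rintro rfl
          rw [c_of_mem_compl (e ⟨i, him⟩).2]
          simp
        · intro hv
          rcases cases_mem v with h | h | h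
          · rw [c_of_mem_A h] at hv
            omega
          · rw [c_of_mem_B h] at hv
            omega
          · rw [c_of_mem_compl h] at hv
            have : e.symm ⟨v, h⟩ = ⟨i, him⟩ := Fin.ext (by simp; omega)
            rw [← this]
            simp
      · simp only [List.get_eq_getElem, List.getElem_cons_succ]
        rw [List.getElem_append_right (by simp), Nat.subtype_card B fun v => (c_eq_iff v).2.symm,
          card_B]
        simp

/-- The first color class of a coloring with the maximal number of ascents consists of local
minima. -/
theorem card_color_one_le {n : ℕ} (w : Equiv.Perm (Fin n)) {c : Fin n → ℕ} (hpos : ∀ v, 1 ≤ c v)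
    (hasc : ∀ u v, u < v → (pathGraph w).Adj u v → c u < c v) :
    Nat.card {v : Fin n // c v = 1} ≤ Nat.card {i : Fin n // LocalMinAt w i} := by
  refine Nat.card_le_card_of_injective
    (fun v => ⟨w.symm v, (localMinAt_iff w _).2 fun u hu => ?_⟩) fun u v h => ?_
  · rw [Equiv.apply_symm_apply] at hu ⊢
    by_contra hlt
    have := hasc u v (lt_of_le_of_ne (not_lt.1 hlt) hu.ne') hu.symm
    have := hpos u
    have := v.2
    omega
  · simpa [Subtype.ext_iff] using h

/-- If `w` has `k` local minima and `j` local maxima with `k < j`,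
then for the composition `α = (k, 1^{n-k-j}, j)` and its reverse
`αʳ = (j, 1^{n-k-j}, k)`, we have `N_{P_w}(α, n-1) > 0` and `N_{P_w}(αʳ, n-1) = 0`. -/
theorem stmt17 (n : ℕ) (w : Equiv.Perm (Fin n)) (k j : ℕ)
    (hk : Nat.card {i : Fin n // LocalMinAt w i} = k)
    (hj : Nat.card {i : Fin n // LocalMaxAt w i} = j)
    (hkj : k < j) :
    0 < NG (pathGraph w) (k :: (List.replicate (n - k - j) 1 ++ [j])) (n - 1) ∧
    NG (pathGraph w) (j :: (List.replicate (n - k - j) 1 ++ [k])) (n - 1) = 0 := by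
  have hn : 2 ≤ n := by
    by_contra hn
    simp only [localMinAt_iff_localMaxAt_of_le_one (by omega : n ≤ 1) w] at hk
    omega
  constructor
  · obtain ⟨c, hasc, hpal⟩ := exists_coloring_of_localExtrema hn w k j hk hj
    have hproper : properColoring (pathGraph w) c := by
      intro u v huv
      rcases lt_or_gt_of_ne huv.ne with h | h
      · exact (hasc u v h huv).ne
      · exact (hasc v u h huv.symm).ne'
    have : Finite {c : Fin n → ℕ // properColoring (pathGraph w) c ∧
        usesPalette (k :: (List.replicate (n - k - j) 1 ++ [j])) c ∧
        ascNum (pathGraph w) c = n - 1} :=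
      ((finite_usesPalette _).subset fun c hc => hc.2.1 : Set.Finite
        {c : Fin n → ℕ | properColoring (pathGraph w) c ∧
          usesPalette (k :: (List.replicate (n - k - j) 1 ++ [j])) c ∧
          ascNum (pathGraph w) c = n - 1})
    exact Nat.card_pos_iff.2 ⟨⟨c, hproper, hpal, (ascNum_pathGraph_eq_iff w c).2 hasc⟩, this⟩
  · rw [NG, Nat.card_eq_zero]
    refine Or.inl ⟨?_⟩
    rintro ⟨c, -, hpal, hasc⟩
    have hle := card_color_one_le w (fun v => (hpal.1 v).1) ((ascNum_pathGraph_eq_iff w c).1 hasc)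
    have hcard : Nat.card {v : Fin n // c v = 1} = j := by
      simpa using hpal.2 ⟨0, by simp⟩
    omega
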